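/- (Baillon–Haddad) Let f : ℝ^d → ℝ be convex and differentiable with L-Lipschitz gradient. Then for all x, y ∈ ℝ^d, ‖∇f(x) − ∇f(y)‖₂² ≤ L·⟨∇f(x) − ∇f(y), x − y⟩, i.e., ∇f is (1/L)-cocoercive. -/

import Mathlib

open Set Filter Topology
open scoped RealInnerProductSpace

noncomputable section

/-- `f` is closed (lower semicontinuous), convex, and proper
as an extended-real-valued function. -/
def ClosedConvexProper {E : Type*} [NormedAddCommGroup E] [NormedSpace ℝ E]
    (f : E → EReal) : Prop :=
  LowerSemicontinuous f ∧
  (∀ (a b : ℝ) (x y : E), 0 ≤ a → 0 ≤ b → a + b = 1 →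
    f (a • x + b • y) ≤ (a : EReal) * f x + (b : EReal) * f y) ∧
  (∀ x, f x ≠ ⊥) ∧ (∃ x, f x ≠ ⊤)

/-- `p` is a minimizer of the prox objective of the extended-real-valued `f` at `x₀`. -/
def IsProxPt {E : Type*} [NormedAddCommGroup E] [InnerProductSpace ℝ E]
    (f : E → EReal) (x₀ p : E) : Prop :=
  IsMinOn (fun x => f x + ((1 / 2 * ‖x - x₀‖ ^ 2 : ℝ) : EReal)) Set.univ p

/-- `p` is a minimizer of the prox objective of the real-valued `f` at `x₀`. -/
def IsProxPtR {E : Type*} [NormedAddCommGroup E] [InnerProductSpace ℝ E]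
    (f : E → ℝ) (x₀ p : E) : Prop :=
  IsMinOn (fun x => f x + 1 / 2 * ‖x - x₀‖ ^ 2) Set.univ p

section helpers

variable {E : Type*} [NormedAddCommGroup E] [InnerProductSpace ℝ E] [CompleteSpace E]

theorem bh_line {f : E → ℝ} {f' : E → E} (hdiff : ∀ x, HasGradientAt f (f' x) x) (x v : E)
    (t : ℝ) : HasDerivAt (fun t : ℝ => f (x + t • v)) ⟪f' (x + t • v), v⟫ t := by
  have h1 : HasDerivAt (fun t : ℝ => x + t • v) v t := by
    simpa using ((hasDerivAt_id t).smul_const v).const_add x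
  have h2 := (hdiff (x + t • v)).hasFDerivAt.comp_hasDerivAt t h1
  simp only [InnerProductSpace.toDual_apply_apply] at h2
  exact h2

theorem bh_grad {f : E → ℝ} {f' : E → E} (hconv : ConvexOn ℝ Set.univ f)
    (hdiff : ∀ x, HasGradientAt f (f' x) x) (x v : E) :
    f x + ⟪f' x, v⟫ ≤ f (x + v) := by
  have hc : ConvexOn ℝ Set.univ (fun t : ℝ => f (x + t • v)) := by
    refine ⟨convex_univ, fun s _ t _ a b ha hb hab => ?_⟩
    have := hconv.2 (mem_univ (x + s • v)) (mem_univ (x + t • v)) ha hb hab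
    convert this using 2
    obtain rfl : b = 1 - a := by linarith
    simp only [smul_eq_mul]
    module
  have h := hc.le_slope_of_hasDerivAt (mem_univ 0) (mem_univ 1) zero_lt_one
    (bh_line hdiff x v 0)
  simp [slope_def_field] at h
  linarith

theorem bh_descent {f : E → ℝ} {f' : E → E}
    (hdiff : ∀ x, HasGradientAt f (f' x) x) (L : ℝ)
    (hLip : ∀ x y, ‖f' x - f' y‖ ≤ L * ‖x - y‖) (x v : E) :
    f (x + v) ≤ f x + ⟪f' x, v⟫ + L / 2 * ‖v‖ ^ 2 := by
  have hd : ∀ t : ℝ, HasDerivAt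
      (fun t : ℝ => f (x + t • v) - (t * ⟪f' x, v⟫ + t ^ 2 * (L / 2 * ‖v‖ ^ 2)))
      (⟪f' (x + t • v), v⟫ - (⟪f' x, v⟫ + 2 * t * (L / 2 * ‖v‖ ^ 2))) t := by
    intro t
    refine (bh_line hdiff x v t).sub (HasDerivAt.add ?_ ?_)
    · simpa using (hasDerivAt_id t).mul_const ⟪f' x, v⟫
    · simpa using (hasDerivAt_pow 2 t).mul_const (L / 2 * ‖v‖ ^ 2)
  have ha := antitoneOn_of_deriv_nonpos (convex_Icc (0 : ℝ) 1)
    (fun t _ => (hd t).continuousAt.continuousWithinAt)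
    (fun t _ => (hd t).differentiableAt.differentiableWithinAt) (by
      intro t ht
      rw [interior_Icc] at ht
      rw [(hd t).deriv]
      have h1 : ⟪f' (x + t • v) - f' x, v⟫ ≤ ‖f' (x + t • v) - f' x‖ * ‖v‖ :=
        real_inner_le_norm _ _
      have h2 := hLip (x + t • v) x
      rw [add_sub_cancel_left, norm_smul, Real.norm_of_nonneg ht.1.le] at h2
      have h3 := mul_le_mul_of_nonneg_right h2 (norm_nonneg v)
      rw [inner_sub_left] at h1
      nlinarith)
  have := ha (left_mem_Icc.2 zero_le_one) (right_mem_Icc.2 zero_le_one) zero_le_one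
  simp at this
  linarith

theorem bh_half {f : E → ℝ} {f' : E → E} (hconv : ConvexOn ℝ Set.univ f)
    (hdiff : ∀ x, HasGradientAt f (f' x) x) (L : ℝ) (hL : 0 < L)
    (hLip : ∀ x y, ‖f' x - f' y‖ ≤ L * ‖x - y‖) (x y : E) :
    ‖f' x - f' y‖ ^ 2 ≤ 2 * L * (f y - f x - ⟪f' x, y - x⟫) := by
  have h1 := bh_descent hdiff L hLip y (L⁻¹ • (f' x - f' y))
  have h2 := bh_grad hconv hdiff x ((y - x) + L⁻¹ • (f' x - f' y))
  rw [show x + ((y - x) + L⁻¹ • (f' x - f' y)) = y + L⁻¹ • (f' x - f' y) by abel,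
    inner_add_right] at h2
  have h3 : ⟪f' x, L⁻¹ • (f' x - f' y)⟫ - ⟪f' y, L⁻¹ • (f' x - f' y)⟫
      = L⁻¹ * ‖f' x - f' y‖ ^ 2 := by
    rw [← inner_sub_left, inner_smul_right, real_inner_self_eq_norm_sq]
  rw [norm_smul, Real.norm_of_nonneg (inv_nonneg.2 hL.le)] at h1
  have h4 : L / 2 * (L⁻¹ * ‖f' x - f' y‖) ^ 2 = L⁻¹ * ‖f' x - f' y‖ ^ 2 / 2 := by
    field_simp
  have h5 : L⁻¹ * ‖f' x - f' y‖ ^ 2 ≤ 2 * (f y - f x - ⟪f' x, y - x⟫) := by linarith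
  have h6 := mul_le_mul_of_nonneg_left h5 hL.le
  rw [mul_inv_cancel_left₀ hL.ne'] at h6
  linarith

end helpers

/-- Baillon–Haddad: the gradient of a convex function with `L`-Lipschitz gradient
is `1/L`-cocoercive. -/
theorem stmt9 {d : ℕ} (f : EuclideanSpace ℝ (Fin d) → ℝ)
    (f' : EuclideanSpace ℝ (Fin d) → EuclideanSpace ℝ (Fin d))
    (hconv : ConvexOn ℝ Set.univ f)
    (hdiff : ∀ x, HasGradientAt f (f' x) x)
    (L : ℝ) (hL : 0 < L)
    (hLip : ∀ x y, ‖f' x - f' y‖ ≤ L * ‖x - y‖) :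
    ∀ x y, ‖f' x - f' y‖ ^ 2 ≤ L * ⟪f' x - f' y, x - y⟫ := by
  intro x y
  have h1 := bh_half hconv hdiff L hL hLip x y
  have h2 := bh_half hconv hdiff L hL hLip y x
  rw [norm_sub_rev] at h2
  have h3 : ⟪f' x - f' y, x - y⟫ = -⟪f' x, y - x⟫ - ⟪f' y, x - y⟫ := by
    rw [inner_sub_left, ← inner_neg_right, neg_sub]
  rw [h3]
  linarith
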